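/- Let g be a continuous real function on S_L. Then Σ_{j=1}^k w_j Φ(f(A_j)) − g(B_L) ≥ ( min_{x ∈ S_L} (x − g(x)) )·1_K in the Loewner order, where g(B_L) is defined by continuous functional calculus and 1_K is the identity operator on K. -/

import Mathlib

open ContinuousLinearMap in
/-- The Kantorovich constant `K(m', M', r)`, with the convention that it equals `1`
for `r = 0` and `r = 1`. -/
noncomputable def kantorovich (m M r : ℝ) : ℝ :=
  if r = 0 ∨ r = 1 then 1 else
    ((m * M ^ r - M * m ^ r) / ((r - 1) * (M - m))) *
      (((r - 1) * (M ^ r - m ^ r)) / (r * (m * M ^ r - M * m ^ r))) ^ r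

open ContinuousLinearMap Polynomial

/-- The Kantorovich constant is at least `1` at natural exponents. -/
theorem one_le_kantorovich_natCast {m M : ℝ} (hm : 0 < m) (hmM : m < M) (n : ℕ) :
    1 ≤ kantorovich m M n := by
  unfold kantorovich
  split_ifs with h
  · exact le_rfl
  push Not at h
  have hn : 2 ≤ n := by
    have h0 : n ≠ 0 := by exact_mod_cast h.1
    have h1 : n ≠ 1 := by exact_mod_cast h.2
    omega
  have hn1 : (0 : ℝ) < n - 1 := by
    have : (2 : ℝ) ≤ n := by exact_mod_cast hn
    linarith
  have hn0 : (0 : ℝ) < n := by linarith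
  simp only [Real.rpow_natCast]
  have hM : 0 < M := hm.trans hmM
  have hd : 0 < M - m := sub_pos.2 hmM
  have hα : 0 < M ^ n - m ^ n := sub_pos.2 (pow_lt_pow_left₀ hmM hm.le (by omega))
  have hβ : 0 < m * M ^ n - M * m ^ n := by
    obtain ⟨p, rfl⟩ : ∃ p, n = p + 1 := ⟨n - 1, by omega⟩
    have : m ^ p < M ^ p := pow_lt_pow_left₀ hmM hm.le (by omega)
    have : 0 < m * M * (M ^ p - m ^ p) := mul_pos (mul_pos hm hM) (sub_pos.2 this)
    calc 0 < m * M * (M ^ p - m ^ p) := this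
      _ = _ := by ring
  have hchord : (M ^ n - m ^ n) * m - (m * M ^ n - M * m ^ n) = m ^ n * (M - m) := by ring
  generalize M ^ n - m ^ n = α at *
  generalize m * M ^ n - M * m ^ n = β at *
  have hu : 0 < (n - 1) * α / (n * β) := by positivity
  have hbern := one_add_mul_sub_le_pow (a := m * ((n - 1) * α / (n * β)))
    (by linarith [mul_pos hm hu]) n
  rw [mul_pow] at hbern
  have hlin : 1 + n * (m * ((n - 1) * α / (n * β)) - 1) = (n - 1) / β * (α * m - β) := by
    field_simp
    ring
  rw [hlin, hchord] at hbern
  generalize ((n - 1) * α / (n * β)) ^ n = t at *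
  have hmn : 0 < m ^ n := pow_pos hm n
  have ht : (n - 1) / β * (M - m) ≤ t := by
    refine le_of_mul_le_mul_left ?_ hmn
    linarith
  calc (1 : ℝ) = β / ((n - 1) * (M - m)) * ((n - 1) / β * (M - m)) := by field_simp
    _ ≤ _ := by gcongr

/-- The infimum over a compact interval of a polynomial positive there is positive. -/
theorem Polynomial.sInf_eval_image_Icc_pos {p : Polynomial ℝ} {m M : ℝ} (hmM : m ≤ M)
    (hp : ∀ x ∈ Set.Icc m M, 0 < p.eval x) :
    0 < sInf ((fun x => p.eval x) '' Set.Icc m M) := by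
  obtain ⟨x, hx, hxe⟩ := (isCompact_Icc.image (f := fun x => p.eval x) p.continuous).sInf_mem
    ((Set.nonempty_Icc.2 hmM).image _)
  rw [← hxe]
  exact hp x hx

/-- Congruence by a bounded operator preserves the Loewner order. -/
theorem ContinuousLinearMap.adjoint_conj_mono
    {H K : Type*} [NormedAddCommGroup H] [InnerProductSpace ℂ H] [CompleteSpace H]
    [NormedAddCommGroup K] [InnerProductSpace ℂ K] [CompleteSpace K]
    (V : K →L[ℂ] H) {S T : H →L[ℂ] H} (h : S ≤ T) :
    (adjoint V) ∘L S ∘L V ≤ (adjoint V) ∘L T ∘L V := by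
  rw [ContinuousLinearMap.le_def] at h ⊢
  have := h.adjoint_conj V
  simpa [ContinuousLinearMap.comp_sub, ContinuousLinearMap.sub_comp] using this

/-- Evaluating a real polynomial expression at `cfc f A` through the functional calculus of `A`. -/
theorem sum_smul_cfc_pow {H : Type*} [NormedAddCommGroup H] [InnerProductSpace ℂ H]
    [CompleteSpace H] {A : H →L[ℂ] H} (hA : IsSelfAdjoint A) {f : ℝ → ℝ}
    (hf : ContinuousOn f (spectrum ℝ A)) (s : Finset ℕ) (a : ℕ → ℝ) :
    ∑ i ∈ s, a i • (cfc f A) ^ i = cfc (fun x => ∑ i ∈ s, a i * f x ^ i) A := by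
  have hfun : (fun x => ∑ i ∈ s, a i * f x ^ i) = ∑ i ∈ s, fun x => a i * f x ^ i := by
    ext x
    simp
  rw [hfun, cfc_sum (fun i x => a i * f x ^ i) A s fun i _ => continuousOn_const.mul (hf.pow i)]
  refine Finset.sum_congr rfl fun i _ => ?_
  rw [cfc_const_mul (a i) (fun x => f x ^ i) A (hf.pow i), cfc_pow f i A hf hA]

theorem stmt15
    {H K : Type*} [NormedAddCommGroup H] [InnerProductSpace ℂ H] [CompleteSpace H]
    [NormedAddCommGroup K] [InnerProductSpace ℂ K] [CompleteSpace K]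
    (V : K →L[ℂ] H) (hV : (adjoint V) ∘L V = 1)
    (I : ℕ) (a : ℕ → ℝ)
    (k : ℕ) (hk : 1 ≤ k)
    (w : Fin k → ℝ) (hw : ∀ j, 0 ≤ w j) (hw1 : ∑ j, w j = 1)
    (m M : Fin k → ℝ) (hmM : ∀ j, m j < M j)
    (A : Fin k → H →L[ℂ] H) (hA : ∀ j, IsSelfAdjoint (A j))
    (hspec : ∀ j, spectrum ℝ (A j) ⊆ Set.Icc (m j) (M j))
    (f : ℝ → ℝ) (hf : ContinuousOn f (⋃ j, Set.Icc (m j) (M j)))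
    (pL pU : Polynomial ℝ)
    (hp : ∀ x ∈ ⋃ j, Set.Icc (m j) (M j),
      0 < pL.eval x ∧ pL.eval x ≤ f x ∧ f x ≤ pU.eval x)
    (mU MU mL ML : Fin k → ℝ)
    (hmU : ∀ j, mU j = sInf ((fun x => pU.eval x) '' Set.Icc (m j) (M j)))
    (hMU : ∀ j, MU j = sSup ((fun x => pU.eval x) '' Set.Icc (m j) (M j)))
    (hmL : ∀ j, mL j = sInf ((fun x => pL.eval x) '' Set.Icc (m j) (M j)))
    (hML : ∀ j, ML j = sSup ((fun x => pL.eval x) '' Set.Icc (m j) (M j)))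
    (hUlt : ∀ j, mU j < MU j) (hLlt : ∀ j, mL j < ML j)
    (qU qL : Fin k → ℝ → ℝ)
    (hqU : ∀ j x, qU j x =
      (∑ i ∈ (Finset.range (I + 1)).filter (fun i => 0 ≤ a i),
        a i * kantorovich (mU j) (MU j) (i : ℝ) * (pU.eval x) ^ i) +
      ∑ i ∈ (Finset.range (I + 1)).filter (fun i => a i < 0),
        a i * (kantorovich (mL j) (ML j) (i : ℝ))⁻¹ * (pL.eval x) ^ i)
    (hqL : ∀ j x, qL j x =
      (∑ i ∈ (Finset.range (I + 1)).filter (fun i => 0 ≤ a i),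
        a i * (kantorovich (mL j) (ML j) (i : ℝ))⁻¹ * (pL.eval x) ^ i) +
      ∑ i ∈ (Finset.range (I + 1)).filter (fun i => a i < 0),
        a i * kantorovich (mU j) (MU j) (i : ℝ) * (pU.eval x) ^ i)
    (BU BL : K →L[ℂ] K)
    (hBU : BU = ∑ j, w j • ((adjoint V) ∘L (cfc (qU j) (A j)) ∘L V))
    (hBL : BL = ∑ j, w j • ((adjoint V) ∘L (cfc (qL j) (A j)) ∘L V))
    (SU SL : Set ℝ)
    (hSU : SU = closure (convexHull ℝ (⋃ j, qU j '' Set.Icc (m j) (M j))))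
    (hSL : SL = closure (convexHull ℝ (⋃ j, qL j '' Set.Icc (m j) (M j))))
    (g : ℝ → ℝ) (hg : ContinuousOn g SL) :
    (sInf ((fun x => x - g x) '' SL)) • (1 : K →L[ℂ] K) ≤
      (∑ j, w j • ((adjoint V) ∘L (∑ i ∈ Finset.range (I + 1), a i • (cfc f (A j)) ^ i) ∘L V)) - cfc g BL := by
  have hIcc : ∀ j, Set.Icc (m j) (M j) ⊆ ⋃ j, Set.Icc (m j) (M j) :=
    fun j => Set.subset_iUnion (fun j => Set.Icc (m j) (M j)) j
  have hKU : ∀ j (i : ℕ), 1 ≤ kantorovich (mU j) (MU j) i := fun j i =>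
    one_le_kantorovich_natCast (by
      rw [hmU]
      refine Polynomial.sInf_eval_image_Icc_pos (hmM j).le fun x hx => ?_
      obtain ⟨h1, h2, h3⟩ := hp x (hIcc j hx)
      linarith) (hUlt j) i
  have hKL : ∀ j (i : ℕ), 1 ≤ kantorovich (mL j) (ML j) i := fun j i =>
    one_le_kantorovich_natCast (by
      rw [hmL]
      exact Polynomial.sInf_eval_image_Icc_pos (hmM j).le fun x hx => (hp x (hIcc j hx)).1)
      (hLlt j) i
  have hqle : ∀ j, ∀ x ∈ Set.Icc (m j) (M j),
      qL j x ≤ ∑ i ∈ Finset.range (I + 1), a i * f x ^ i := by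
    intro j x hx
    obtain ⟨h1, h2, h3⟩ := hp x (hIcc j hx)
    rw [hqL, ← Finset.sum_filter_add_sum_filter_not (Finset.range (I + 1)) (fun i => 0 ≤ a i)]
    simp only [not_le]
    refine add_le_add (Finset.sum_le_sum fun i hi => ?_) (Finset.sum_le_sum fun i hi => ?_)
    · have hai := (Finset.mem_filter.1 hi).2
      rw [mul_assoc]
      refine mul_le_mul_of_nonneg_left ?_ hai
      calc _ ≤ 1 * pL.eval x ^ i :=
            mul_le_mul_of_nonneg_right (inv_le_one_of_one_le₀ (hKL j i)) (pow_nonneg h1.le i)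
        _ = pL.eval x ^ i := one_mul _
        _ ≤ f x ^ i := pow_le_pow_left₀ h1.le h2 i
    · have hai := (Finset.mem_filter.1 hi).2
      rw [mul_assoc]
      refine mul_le_mul_of_nonpos_left ?_ hai.le
      have h0 : 0 ≤ pU.eval x := by linarith
      calc f x ^ i ≤ pU.eval x ^ i := pow_le_pow_left₀ (by linarith) h3 i
        _ = 1 * pU.eval x ^ i := (one_mul _).symm
        _ ≤ _ := mul_le_mul_of_nonneg_right (hKU j i) (pow_nonneg h0 i)
  have hqc : ∀ j, Continuous (qL j) := by
    intro j
    rw [funext (hqL j)]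
    fun_prop
  have hfc : ∀ j, ContinuousOn f (spectrum ℝ (A j)) := fun j =>
    hf.mono ((hspec j).trans (hIcc j))
  have hsum : ∀ j, ∑ i ∈ Finset.range (I + 1), a i • (cfc f (A j)) ^ i =
      cfc (fun x => ∑ i ∈ Finset.range (I + 1), a i * f x ^ i) (A j) := by
    intro j
    exact sum_smul_cfc_pow (hA j) (hfc j) _ a
  have hBLle : BL ≤ ∑ j, w j •
      ((adjoint V) ∘L (∑ i ∈ Finset.range (I + 1), a i • (cfc f (A j)) ^ i) ∘L V) := by
    rw [hBL]
    refine Finset.sum_le_sum fun j _ => smul_le_smul_of_nonneg_left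
      (adjoint_conj_mono V ?_) (hw j)
    rw [hsum j]
    have hfj := hfc j
    exact cfc_mono (fun x hx => hqle j x (hspec j hx)) (hqc j).continuousOn (by fun_prop)
  have hSLc : IsCompact SL := by
    rw [hSL]
    refine Bornology.IsBounded.isCompact_closure (isBounded_convexHull.2 ?_)
    exact (isCompact_iUnion fun j => isCompact_Icc.image (hqc j)).isBounded
  have hSLconv : Convex ℝ SL := hSL ▸ (convex_convexHull ℝ _).closure
  have hmem : ∀ j, ∀ x ∈ Set.Icc (m j) (M j), qL j x ∈ SL := fun j x hx => hSL ▸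
    subset_closure (subset_convexHull ℝ _ (Set.mem_iUnion.2 ⟨j, x, hx, rfl⟩))
  have hSLne : SL.Nonempty :=
    ⟨_, hmem ⟨0, hk⟩ _ (Set.left_mem_Icc.2 (hmM _).le)⟩
  have hconst : ∀ c : ℝ, ∑ j, w j • ((adjoint V) ∘L (algebraMap ℝ (H →L[ℂ] H) c) ∘L V) =
      algebraMap ℝ (K →L[ℂ] K) c := by
    intro c
    have : (adjoint V) ∘L (algebraMap ℝ (H →L[ℂ] H) c) ∘L V = c • (1 : K →L[ℂ] K) := by
      rw [← hV]
      ext x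
      simp [Algebra.algebraMap_eq_smul_one]
    rw [this, ← Finset.sum_smul, hw1, one_smul, Algebra.algebraMap_eq_smul_one]
  have hlow : algebraMap ℝ (K →L[ℂ] K) (sInf SL) ≤ BL := by
    rw [hBL, ← hconst]
    refine Finset.sum_le_sum fun j _ => smul_le_smul_of_nonneg_left
      (adjoint_conj_mono V ?_) (hw j)
    exact algebraMap_le_cfc (qL j) _ (A j)
      (fun x hx => csInf_le hSLc.bddBelow (hmem j x (hspec j hx))) (hqc j).continuousOn (hA j)
  have hupp : BL ≤ algebraMap ℝ (K →L[ℂ] K) (sSup SL) := by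
    rw [hBL, ← hconst]
    refine Finset.sum_le_sum fun j _ => smul_le_smul_of_nonneg_left
      (adjoint_conj_mono V ?_) (hw j)
    exact cfc_le_algebraMap (qL j) _ (A j)
      (fun x hx => le_csSup hSLc.bddAbove (hmem j x (hspec j hx))) (hqc j).continuousOn (hA j)
  have hBLsa : IsSelfAdjoint BL := by
    have h : IsSelfAdjoint (algebraMap ℝ (K →L[ℂ] K) (sInf SL)) := .algebraMap _ (.all _)
    simpa using (IsSelfAdjoint.of_nonneg (sub_nonneg.2 hlow)).add h
  have hspecBL : spectrum ℝ BL ⊆ SL := fun x hx =>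
    hSLconv.ordConnected.out (hSLc.sInf_mem hSLne) (hSLc.sSup_mem hSLne)
      ⟨(algebraMap_le_iff_le_spectrum hBLsa).1 hlow x hx,
        (le_algebraMap_iff_spectrum_le hBLsa).1 hupp x hx⟩
  have hgc : ContinuousOn g (spectrum ℝ BL) := hg.mono hspecBL
  have hmin : (sInf ((fun x => x - g x) '' SL)) • (1 : K →L[ℂ] K) ≤ BL - cfc g BL := by
    have hbdd : BddBelow ((fun x => x - g x) '' SL) :=
      (hSLc.image_of_continuousOn (continuousOn_id.sub hg)).bddBelow
    have h := algebraMap_le_cfc (fun x => x - g x) (sInf ((fun x => x - g x) '' SL)) BL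
      (fun x hx => csInf_le hbdd ⟨x, hspecBL hx, rfl⟩) (continuousOn_id.sub hgc) hBLsa
    rw [cfc_sub (fun x => x) g BL, cfc_id' ℝ BL] at h
    rwa [Algebra.algebraMap_eq_smul_one] at h
  exact hmin.trans (sub_le_sub_right hBLle _)
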